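/- Let T₁ and T₂ be G-trees such that every edge stabilizer of T₁ is elliptic in T₂. If every element of G that is elliptic in T₁ is also elliptic in T₂, then T₁ dominates T₂, i.e., every subgroup of G elliptic in T₁ is elliptic in T₂. -/

import Mathlib

universe u v

/-- A `G`-tree: a nonempty simple graph which is a tree (connected and acyclic),
with a minimal action of `G` by graph automorphisms without inversions. -/
structure GTree (G : Type u) [Group G] : Type (u + 1) where
  V : Type u
  graph : SimpleGraph V
  nonempty : Nonempty V
  connected : graph.Connected
  acyclic : graph.IsAcyclic
  act : G → V → V
  act_one : ∀ w, act 1 w = w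
  act_mul : ∀ g h w, act (g * h) w = act g (act h w)
  act_adj : ∀ g a b, graph.Adj a b → graph.Adj (act g a) (act g b)
  noInversion : ∀ g a b, graph.Adj a b → ¬(act g a = b ∧ act g b = a)
  minimal : ∀ S : Set V, S.Nonempty → (∀ g, ∀ w ∈ S, act g w ∈ S) →
    (graph.induce S).Connected → S = Set.univ

namespace GTree

variable {G : Type u} [Group G]

/-- The stabilizer of a vertex. -/
def vertexStab (T : GTree G) (w : T.V) : Subgroup G where
  carrier := {g | T.act g w = w}
  one_mem' := T.act_one w
  mul_mem' := by
    intro a b ha hb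
    simp only [Set.mem_setOf_eq] at *
    rw [T.act_mul, hb, ha]
  inv_mem' := by
    intro a ha
    simp only [Set.mem_setOf_eq] at *
    calc T.act a⁻¹ w = T.act a⁻¹ (T.act a w) := by rw [ha]
    _ = T.act (a⁻¹ * a) w := (T.act_mul _ _ _).symm
    _ = w := by rw [inv_mul_cancel, T.act_one]

/-- The stabilizer of an edge `{u,v}`: elements fixing both endpoints. -/
def edgeStab (T : GTree G) (a b : T.V) : Subgroup G :=
  T.vertexStab a ⊓ T.vertexStab b

/-- A subgroup is elliptic in `T` if it fixes a vertex. -/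
def EllipticSubgroup (T : GTree G) (H : Subgroup G) : Prop :=
  ∃ w : T.V, ∀ h ∈ H, T.act h w = w

/-- An element is elliptic in `T` if it fixes a vertex (otherwise it is hyperbolic). -/
def EllipticElt (T : GTree G) (g : G) : Prop :=
  ∃ w : T.V, T.act g w = w

/-- `T₁` dominates `T₂`: every subgroup elliptic in `T₁` is elliptic in `T₂`. -/
def Dominates (T₁ T₂ : GTree G) : Prop :=
  ∀ H : Subgroup G, T₁.EllipticSubgroup H → T₂.EllipticSubgroup H

/-- `T` is an `𝒜`-tree: all its edge stabilizers belong to `𝒜`. -/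
def IsATree (T : GTree G) (𝒜 : Set (Subgroup G)) : Prop :=
  ∀ a b : T.V, T.graph.Adj a b → T.edgeStab a b ∈ 𝒜

/-- A subgroup is universally elliptic if it is elliptic in every `𝒜`-tree. -/
def UnivEllipticSubgroup (𝒜 : Set (Subgroup G)) (H : Subgroup G) : Prop :=
  ∀ T : GTree G, T.IsATree 𝒜 → T.EllipticSubgroup H

/-- An `𝒜`-tree is universally elliptic if all its edge stabilizers are universally elliptic. -/
def UnivEllipticTree (T : GTree G) (𝒜 : Set (Subgroup G)) : Prop :=
  ∀ a b : T.V, T.graph.Adj a b → UnivEllipticSubgroup 𝒜 (T.edgeStab a b)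

/-- A JSJ tree of `G` over `𝒜`: a universally elliptic `𝒜`-tree dominating every
universally elliptic `𝒜`-tree. -/
def IsJSJ (T : GTree G) (𝒜 : Set (Subgroup G)) : Prop :=
  T.IsATree 𝒜 ∧ T.UnivEllipticTree 𝒜 ∧
    ∀ T' : GTree G, T'.IsATree 𝒜 → T'.UnivEllipticTree 𝒜 → T.Dominates T'

/-- A collapse map `T → T'`: a `G`-equivariant surjection on vertices sending adjacent
vertices to adjacent or equal vertices, with connected point preimages. -/
def IsCollapseMap (T T' : GTree G) (f : T.V → T'.V) : Prop :=
  (∀ g w, f (T.act g w) = T'.act g (f w)) ∧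
    Function.Surjective f ∧
    (∀ a b : T.V, T.graph.Adj a b → f a = f b ∨ T'.graph.Adj (f a) (f b)) ∧
    ∀ w : T'.V, (T.graph.induce (f ⁻¹' {w})).Connected

end GTree

/-- `𝒜` is closed under conjugation and under passing to subgroups. -/
def ClosedFamily {G : Type u} [Group G] (𝒜 : Set (Subgroup G)) : Prop :=
  (∀ H ∈ 𝒜, ∀ g : G, Subgroup.map (MulAut.conj g).toMonoidHom H ∈ 𝒜) ∧
    ∀ H ∈ 𝒜, ∀ K : Subgroup G, K ≤ H → K ∈ 𝒜

/-- `G` is finitely presented: it admits a presentation with finitely many generators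
and finitely many relations. -/
def FinitelyPresentedGroup (G : Type u) [Group G] : Prop :=
  ∃ (n : ℕ) (rels : Set (FreeGroup (Fin n))),
    rels.Finite ∧ Nonempty (PresentedGroup rels ≃* G)

/-- `T` is an `(𝒜,ℋ)`-tree: an `𝒜`-tree in which every subgroup in `ℋ` is elliptic. -/
def RelATree {G : Type u} [Group G] (𝒜 ℋ : Set (Subgroup G)) (T : GTree G) : Prop :=
  T.IsATree 𝒜 ∧ ∀ H ∈ ℋ, T.EllipticSubgroup H

/-- A subgroup is universally elliptic relative to `ℋ` if it is elliptic in every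
`(𝒜,ℋ)`-tree. -/
def RelUnivEllipticSubgroup {G : Type u} [Group G] (𝒜 ℋ : Set (Subgroup G))
    (K : Subgroup G) : Prop :=
  ∀ T : GTree G, RelATree 𝒜 ℋ T → T.EllipticSubgroup K

/-- An `(𝒜,ℋ)`-tree is universally elliptic if all its edge stabilizers are universally
elliptic relative to `ℋ`. -/
def RelUnivEllipticTree {G : Type u} [Group G] (𝒜 ℋ : Set (Subgroup G))
    (T : GTree G) : Prop :=
  ∀ a b : T.V, T.graph.Adj a b → RelUnivEllipticSubgroup 𝒜 ℋ (T.edgeStab a b)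

/-- A JSJ tree of `G` over `𝒜` relative to `ℋ`. -/
def IsRelJSJ {G : Type u} [Group G] (𝒜 ℋ : Set (Subgroup G)) (T : GTree G) : Prop :=
  RelATree 𝒜 ℋ T ∧ RelUnivEllipticTree 𝒜 ℋ T ∧
    ∀ T' : GTree G, RelATree 𝒜 ℋ T' → RelUnivEllipticTree 𝒜 ℋ T' → T.Dominates T'

/-- The family of groups `F, H₁, …, H_p` whose free product is used to define relative
finite presentability. -/
def relFam {G : Type u} [Group G] {p : ℕ} (H : Fin p → Subgroup G) (n : ℕ) :
    Option (Fin p) → Type u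
  | none => FreeGroup (ULift.{u} (Fin n))
  | some j => H j

instance relFamGroup {G : Type u} [Group G] {p : ℕ} (H : Fin p → Subgroup G) (n : ℕ) :
    (i : Option (Fin p)) → Group (relFam H n i)
  | none => inferInstanceAs (Group (FreeGroup _))
  | some j => inferInstanceAs (Group (H j))

/-- `G` is finitely presented relative to `H₁, …, H_p`: there is a surjection from
`F ∗ H₁ ∗ ⋯ ∗ H_p` (with `F` a finitely generated free group) onto `G` restricting to
the inclusion on each `Hᵢ`, whose kernel is the normal closure of a finite subset. -/
def RelFinitelyPresented {G : Type u} [Group G] {p : ℕ} (H : Fin p → Subgroup G) : Prop :=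
  ∃ (n : ℕ) (φ : Monoid.CoprodI (relFam H n) →* G),
    Function.Surjective φ ∧
    (∀ (j : Fin p) (h : H j), φ (Monoid.CoprodI.of (M := relFam H n) (i := some j) h) = (h : G)) ∧
    ∃ s : Set (Monoid.CoprodI (relFam H n)), s.Finite ∧
      MonoidHom.ker φ = Subgroup.normalClosure s

/-- `S` has a single orbit of edges. -/
def OneEdgeOrbit {G : Type u} [Group G] (S : GTree G) : Prop :=
  ∀ e₁ ∈ S.graph.edgeSet, ∀ e₂ ∈ S.graph.edgeSet, ∃ g : G, Sym2.map (S.act g) e₁ = e₂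

/-- `G` splits over `K`: there is a nontrivial `G`-tree with a single orbit of edges
having `K` as an edge stabilizer. -/
def SplitsOver {G : Type u} [Group G] (K : Subgroup G) : Prop :=
  ∃ S : GTree G, Nontrivial S.V ∧ OneEdgeOrbit S ∧
    ∃ x y : S.V, S.graph.Adj x y ∧ S.edgeStab x y = K

/-- A subgroup is slender if all its subgroups are finitely generated. -/
def SlenderSubgroup {G : Type u} [Group G] (H : Subgroup G) : Prop :=
  ∀ K : Subgroup G, K ≤ H → K.FG

/-- A subgroup is abelian. -/
def AbelianSubgroup {G : Type u} [Group G] (H : Subgroup G) : Prop :=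
  ∀ a ∈ H, ∀ b ∈ H, a * b = b * a

/-- `H` is malnormal in `G`: `gHg⁻¹ ∩ H ≠ {1}` implies `g ∈ H`. -/
def Malnormal {G : Type u} [Group G] (H : Subgroup G) : Prop :=
  ∀ g : G, (∃ x ∈ H, x ≠ 1 ∧ g * x * g⁻¹ ∈ H) → g ∈ H

/-- `G` is CSA: the centralizer of every nontrivial element is abelian and malnormal. -/
def IsCSA (G : Type u) [Group G] : Prop :=
  ∀ g : G, g ≠ 1 →
    AbelianSubgroup (Subgroup.centralizer {g}) ∧ Malnormal (Subgroup.centralizer {g})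

namespace SimpleGraph

variable {V W : Type*} {Γ : SimpleGraph V}

/-- In a tree, a vertex has at most one neighbour closer to a given vertex. -/
theorem IsTree.eq_of_adj_of_dist_lt (hΓ : Γ.IsTree) {q x p p' : V} (hp : Γ.Adj x p)
    (hp' : Γ.Adj x p') (hd : Γ.dist q p < Γ.dist q x) (hd' : Γ.dist q p' < Γ.dist q x) :
    p = p' := by
  have key : ∀ {r : V} (h : Γ.Adj x r), Γ.dist q r < Γ.dist q x →
      ∃ w : Γ.Walk r q, (Walk.cons h w).IsPath := by
    intro r h hlt
    obtain ⟨w, hw⟩ := hΓ.connected.exists_walk_length_eq_dist r q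
    refine ⟨w, Walk.isPath_of_length_eq_dist _ ?_⟩
    have := hΓ.dist_eq_dist_add_one_of_adj q h
    rw [Walk.length_cons, hw, dist_comm, dist_comm (u := x)]
    omega
  obtain ⟨w, hw⟩ := key hp hd
  obtain ⟨w', hw'⟩ := key hp' hd'
  have heq : Walk.cons hp w = Walk.cons hp' w' :=
    (hΓ.existsUnique_path x q).unique hw hw'
  simpa using congrArg Walk.snd heq

/-- In a tree, if the first step of a geodesic from `x` to `z` moves away from `q`, then `x`
lies between `q` and `z`. -/
theorem IsTree.dist_eq_add_of_adj (hΓ : Γ.IsTree) {q z : V} (n : ℕ) :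
    ∀ {x p : V}, Γ.Adj x p → Γ.dist p z = n → Γ.dist x z = n + 1 →
      Γ.dist q x ≤ Γ.dist q p → Γ.dist q z = Γ.dist q x + (n + 1) := by
  induction n with
  | zero =>
    intro x p hxp hpz _ hle
    obtain rfl := hΓ.connected.dist_eq_zero_iff.mp hpz
    have := hΓ.dist_eq_dist_add_one_of_adj q hxp
    omega
  | succ n ih =>
    intro x p hxp hpz hxz hle
    obtain ⟨w, hw⟩ := hΓ.connected.exists_walk_length_eq_dist p z
    cases w with
    | nil => simp at hpz
    | @cons _ r _ hpr w =>
      have h1 : Γ.dist r z ≤ w.length := dist_le w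
      rw [Walk.length_cons] at hw
      have h2 := hΓ.dist_eq_dist_add_one_of_adj z hpr
      rw [dist_comm (u := z), dist_comm (u := z)] at h2
      have h3 := hΓ.dist_eq_dist_add_one_of_adj q hxp
      have hrz : Γ.dist r z = n := by omega
      have hpr' : Γ.dist q p ≤ Γ.dist q r := by
        by_contra! hlt
        have := hΓ.eq_of_adj_of_dist_lt hxp.symm hpr (by omega : Γ.dist q x < Γ.dist q p) hlt
        subst this
        omega
      have := ih hpr hrz hpz hpr'
      omega

theorem Connected.exists_adj_dist_eq (hΓ : Γ.Connected) {x z : V} {n : ℕ}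
    (h : Γ.dist x z = n + 1) : ∃ p, Γ.Adj x p ∧ Γ.dist p z = n := by
  obtain ⟨w, hw⟩ := hΓ.exists_walk_length_eq_dist x z
  cases w with
  | nil => simp at h
  | @cons _ r _ hxr w =>
    refine ⟨r, hxr, ?_⟩
    have h1 : Γ.dist r z ≤ w.length := dist_le w
    rw [Walk.length_cons] at hw
    have h2 := hΓ.dist_triangle (u := x) (v := r) (w := z)
    have h3 := dist_eq_one_iff_adj.mpr hxr
    omega

/-- A walk in a graph which maps to an acyclic graph in a locally injective way can be replaced
by one with the same endpoints whose image is a path. -/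
theorem Walk.exists_map_isPath {Δ : SimpleGraph W} (π : Δ →g Γ) (hΓ : Γ.IsAcyclic)
    (hπ : ∀ ⦃x y y'⦄, Δ.Adj x y → Δ.Adj x y' → π y = π y' → y = y') {x y : W}
    (w : Δ.Walk x y) : ∃ w' : Δ.Walk x y, (w'.map π).IsPath := by
  induction w with
  | nil => exact ⟨.nil, by simp⟩
  | @cons x r y hxr w ih =>
    obtain ⟨w', hw'⟩ := ih
    by_cases hx : π x ∈ (w'.map π).support
    · have hsnd := hΓ.eq_snd_of_adj_start hw' (π.map_adj hxr.symm) hx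
      cases w' with
      | nil =>
        simp only [Walk.map_nil, Walk.support_nil, List.mem_singleton] at hx
        exact absurd hx (π.map_adj hxr).ne
      | @cons _ s _ hrs w' =>
        simp only [Walk.map_cons, Walk.snd_cons] at hsnd
        obtain rfl := hπ hxr.symm hrs hsnd
        rw [Walk.map_cons, Walk.cons_isPath_iff] at hw'
        exact ⟨w', hw'.1⟩
    · exact ⟨.cons hxr w', by rw [Walk.map_cons, Walk.cons_isPath_iff]; exact ⟨hw', hx⟩⟩

/-- A locally injective homomorphism to an acyclic graph is injective on connected components. -/
theorem Reachable.eq_of_map_eq {Δ : SimpleGraph W} (π : Δ →g Γ) (hΓ : Γ.IsAcyclic)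
    (hπ : ∀ ⦃x y y'⦄, Δ.Adj x y → Δ.Adj x y' → π y = π y' → y = y') {x y : W}
    (h : Δ.Reachable x y) (hxy : π x = π y) : x = y := by
  obtain ⟨w⟩ := h
  obtain ⟨w', hw'⟩ := w.exists_map_isPath π hΓ hπ
  cases w' with
  | nil => rfl
  | cons hadj w' =>
    rw [Walk.map_cons, Walk.cons_isPath_iff, hxy] at hw'
    exact absurd (Walk.end_mem_support _) hw'.2

end SimpleGraph

namespace GTree

open SimpleGraph

variable {G : Type u} [Group G]

theorem isTree (T : GTree G) : T.graph.IsTree := ⟨T.connected, T.acyclic⟩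

@[simp]
theorem act_inv_act (T : GTree G) (g : G) (w : T.V) : T.act g⁻¹ (T.act g w) = w := by
  rw [← T.act_mul, inv_mul_cancel, T.act_one]

@[simp]
theorem act_act_inv (T : GTree G) (g : G) (w : T.V) : T.act g (T.act g⁻¹ w) = w := by
  rw [← T.act_mul, mul_inv_cancel, T.act_one]

theorem dist_act (T : GTree G) (g : G) (a b : T.V) :
    T.graph.dist (T.act g a) (T.act g b) = T.graph.dist a b := by
  have key : ∀ (g : G) (a b : T.V), T.graph.dist (T.act g a) (T.act g b) ≤ T.graph.dist a b := by
    intro g a b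
    obtain ⟨w, hw⟩ := T.connected.exists_walk_length_eq_dist a b
    let φ : T.graph →g T.graph := ⟨T.act g, fun h => T.act_adj g _ _ h⟩
    rw [← hw, ← w.length_map φ]
    exact dist_le _
  exact le_antisymm (key g a b) (by simpa using key g⁻¹ (T.act g a) (T.act g b))

/-- An elliptic element sends a half-tree issued from a fixed vertex off itself, as soon as it
moves the first vertex of this half-tree. -/
theorem dist_le_dist_act (T : GTree G) {a : G} {x p q : T.V} (hx : T.act a x = x)
    (hp : T.act a p ≠ p) (hxp : T.graph.Adj x p) (hq : T.graph.dist q p < T.graph.dist q x) :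
    T.graph.dist (T.act a q) x ≤ T.graph.dist (T.act a q) p := by
  by_contra! hlt
  refine hp (T.isTree.eq_of_adj_of_dist_lt (q := T.act a q) (x := x) ?_ hxp ?_ hlt)
  · simpa [hx] using T.act_adj a _ _ hxp
  · rw [T.dist_act]
    calc _ < _ := hq
      _ = T.graph.dist (T.act a q) (T.act a x) := (T.dist_act a q x).symm
      _ = _ := by rw [hx]

/-- A set of elements is elliptic if it has a common fixed vertex. -/
def EllipticSet (T : GTree G) (Z : Set G) : Prop :=
  ∃ w : T.V, ∀ g ∈ Z, T.act g w = w

/-- If the product of any element of an elliptic set with any element of another one is elliptic,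
then both sets have a common fixed vertex. -/
theorem EllipticSet.union {T : GTree G} {A B : Set G} (hA : T.EllipticSet A)
    (hB : T.EllipticSet B) (hAB : ∀ a ∈ A, ∀ b ∈ B, T.EllipticElt (a * b)) :
    T.EllipticSet (A ∪ B) := by
  let P : ℕ → Prop := fun n => ∃ x z, (∀ a ∈ A, T.act a x = x) ∧ (∀ b ∈ B, T.act b z = z) ∧
    T.graph.dist x z = n
  have hP : ∃ n, P n := by
    obtain ⟨x, hx⟩ := hA
    obtain ⟨z, hz⟩ := hB
    exact ⟨_, x, z, hx, hz, rfl⟩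
  classical
  obtain ⟨x, z, hx, hz, hd⟩ := Nat.find_spec hP
  have hmin : ∀ m, P m → Nat.find hP ≤ m := fun m hm => Nat.find_min' hP hm
  generalize Nat.find hP = n at hd hmin
  cases n with
  | zero =>
    obtain rfl := T.connected.dist_eq_zero_iff.mp hd
    exact ⟨x, fun g hg => hg.elim (hx g) (hz g)⟩
  | succ n =>
    exfalso
    obtain ⟨p, hxp, hpz⟩ := T.connected.exists_adj_dist_eq hd
    have hd' := hd
    rw [dist_comm] at hd'
    obtain ⟨r, hzr, hrx⟩ := T.connected.exists_adj_dist_eq hd'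
    obtain ⟨a, ha, hap⟩ : ∃ a ∈ A, T.act a p ≠ p := by
      by_contra! h
      have := hmin n ⟨p, z, h, hz, hpz⟩
      omega
    obtain ⟨b, hb, hbr⟩ : ∃ b ∈ B, T.act b r ≠ r := by
      by_contra! h
      have := hmin n ⟨x, r, hx, h, by rw [dist_comm]; exact hrx⟩
      omega
    obtain ⟨q, hq⟩ := hAB a ha b hb
    rw [T.act_mul] at hq
    have hqx : T.graph.dist (T.act b q) x = T.graph.dist q x := by
      have := T.dist_act a (T.act b q) x
      rwa [hq, hx a ha, eq_comm] at this
    have hqz : T.graph.dist (T.act b q) z = T.graph.dist q z := by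
      have := T.dist_act b q z
      rwa [hz b hb] at this
    have h1 : T.graph.dist q z = T.graph.dist q x + (n + 1) := by
      rcases lt_or_ge (T.graph.dist (T.act b q) p) (T.graph.dist (T.act b q) x) with hlt | hge
      · have := T.dist_le_dist_act (hx a ha) hap hxp hlt
        rw [hq] at this
        exact T.isTree.dist_eq_add_of_adj n hxp hpz hd this
      · have := T.isTree.dist_eq_add_of_adj n hxp hpz hd hge
        rwa [hqx, hqz] at this
    have h2 : T.graph.dist q r < T.graph.dist q z := by
      have := T.connected.dist_triangle (u := q) (v := x) (w := r)
      rw [dist_comm (u := x), hrx] at this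
      omega
    have h3 := T.isTree.dist_eq_add_of_adj n hzr hrx hd'
      (T.dist_le_dist_act (hz b hb) hbr hzr h2)
    omega

/-- If a subgroup consists of elliptic elements, then a finite union of elliptic subsets is
elliptic. -/
theorem EllipticSet.iUnion {T : GTree G} {H : Subgroup G} (hH : ∀ g ∈ H, T.EllipticElt g)
    {ι : Type*} [Finite ι] {Z : ι → Set G} (hZ : ∀ i, T.EllipticSet (Z i))
    (hZH : ∀ i, Z i ⊆ H) : T.EllipticSet (⋃ i, Z i) := by
  have key : ∀ s : Set ι, s.Finite → T.EllipticSet (⋃ i ∈ s, Z i) := by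
    intro s hs
    induction s, hs using Set.Finite.induction_on with
    | empty => exact T.nonempty.elim fun w => ⟨w, by simp⟩
    | @insert i s _ _ ih =>
      rw [Set.biUnion_insert]
      refine (hZ i).union ih fun a ha b hb => hH _ (mul_mem (hZH i ha) ?_)
      obtain ⟨j, _, hj⟩ := Set.mem_iUnion₂.mp hb
      exact hZH j hj
  simpa using key Set.univ Set.finite_univ

/-- Compatible choice of vertices of `T₂` indexed by the vertices of `T₁`: the choice is
equivariant as far as edges between vertices of the finite set `X`, or elements of the finite set
`S`, can see. -/
theorem exists_compatible_map {T₁ T₂ : GTree G}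
    (hell : ∀ a b : T₁.V, T₁.graph.Adj a b → T₂.EllipticSubgroup (T₁.edgeStab a b))
    (helts : ∀ g : G, T₁.EllipticElt g → T₂.EllipticElt g)
    (X : Set T₁.V) [Finite X] (S : Set G) [Finite S] :
    ∃ y : T₁.V → T₂.V,
      (∀ u ∈ X, ∀ u' ∈ X, ∀ r ∈ X, ∀ r' ∈ X, T₁.graph.Adj u u' → ∀ k, T₁.act k u = r →
        T₁.act k u' = r' → T₂.act k (y u) = y r) ∧
      ∀ s ∈ S, ∀ u ∈ X, ∀ r ∈ X, T₁.act s u = r → T₂.act s (y u) = y r := by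
  obtain ⟨ρ, γ, hγ, hρ⟩ : ∃ (ρ : T₁.V → T₁.V) (γ : T₁.V → G), (∀ u, T₁.act (γ u) (ρ u) = u) ∧
      ∀ k u, ρ (T₁.act k u) = ρ u := by
    let orb : Setoid T₁.V :=
      { r := fun a b => ∃ g, T₁.act g a = b
        iseqv :=
          { refl := fun a => ⟨1, T₁.act_one a⟩
            symm := by rintro a _ ⟨g, rfl⟩; exact ⟨g⁻¹, T₁.act_inv_act g a⟩
            trans := by
              rintro a _ _ ⟨g, rfl⟩ ⟨h, rfl⟩
              exact ⟨h * g, T₁.act_mul h g a⟩ } }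
    choose γ hγ using fun u : T₁.V => Quotient.mk_out (s := orb) u
    refine ⟨fun u => (Quotient.mk orb u).out, γ, hγ, fun k u => ?_⟩
    exact congrArg Quotient.out (Quotient.sound (s := orb) ⟨k⁻¹, T₁.act_inv_act k u⟩)
  have hγinv : ∀ u, T₁.act (γ u)⁻¹ u = ρ u := fun u => by
    simpa [hγ] using T₁.act_inv_act (γ u) (ρ u)
  have hfix : ∀ {k u r}, T₁.act k u = r → T₁.act ((γ r)⁻¹ * k * γ u) (ρ u) = ρ u := by
    rintro k u _ rfl
    rw [T₁.act_mul, T₁.act_mul, hγ, hγinv, hρ]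
  have hstab : ∀ w, ∀ g ∈ T₁.vertexStab w, T₂.EllipticElt g := fun w g hg => helts g ⟨w, hg⟩
  let Z (w : T₁.V) : (X × X × X × X) ⊕ (S × X × X) → Set G := Sum.elim
    (fun i => {x | ∃ k, ρ i.1 = w ∧ T₁.graph.Adj i.1 i.2.1 ∧ T₁.act k i.1 = i.2.2.1 ∧
      T₁.act k i.2.1 = i.2.2.2 ∧ x = (γ i.2.2.1)⁻¹ * k * γ i.1})
    (fun i => {x | ρ i.2.1 = w ∧ T₁.act i.1 i.2.1 = i.2.2 ∧
      x = (γ i.2.2)⁻¹ * i.1 * γ i.2.1})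
  have hZ : ∀ w, T₂.EllipticSet (⋃ i, Z w i) := by
    intro w
    refine EllipticSet.iUnion (hstab w) (fun i => ?_) (fun i => ?_)
    · rcases (Z w i).eq_empty_or_nonempty with he | ⟨x, hx⟩
      · rw [he]
        exact T₂.nonempty.elim fun z => ⟨z, by simp⟩
      rcases i with ⟨⟨u, _⟩, ⟨u', _⟩, ⟨r, _⟩, ⟨r', _⟩⟩ | ⟨⟨s, _⟩, ⟨u, _⟩, ⟨r, _⟩⟩
      · obtain ⟨k, rfl, hadj, hk, hk', rfl⟩ := hx
        simp only at hadj hk hk'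
        have hx₀ := hfix hk
        set x₀ := (γ r)⁻¹ * k * γ u with hx₀_def
        let E : Set G := {x | γ u * x * (γ u)⁻¹ ∈ T₁.edgeStab u u'}
        have hE : T₂.EllipticSet E := by
          obtain ⟨z, hz⟩ := hell u u' hadj
          refine ⟨T₂.act (γ u)⁻¹ z, fun x hx => ?_⟩
          have := hz _ hx
          rw [T₂.act_mul, T₂.act_mul] at this
          conv_rhs => rw [← this]
          simp
        have hEstab : E ⊆ T₁.vertexStab (ρ u) := by
          intro x hx
          have : T₁.act (γ u * x * (γ u)⁻¹) u = u := hx.1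
          change T₁.act x (ρ u) = ρ u
          rw [T₁.act_mul, T₁.act_mul, hγinv] at this
          rw [← T₁.act_inv_act (γ u) (T₁.act x (ρ u)), this, hγinv]
        have hx₀E : T₂.EllipticSet {x₀} :=
          (hstab _ x₀ hx₀).imp fun z hz g hg => by rwa [Set.mem_singleton_iff.mp hg]
        obtain ⟨z, hz⟩ := hx₀E.union hE fun a ha b hb => hstab (ρ u) _ <|
          mul_mem (by rw [Set.mem_singleton_iff.mp ha]; exact hx₀) (hEstab hb)
        refine ⟨z, ?_⟩
        rintro _ ⟨l, -, -, hl, hl', rfl⟩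
        simp only at hl hl'
        have hmem : (γ u)⁻¹ * (k⁻¹ * l) * γ u ∈ E := by
          have : γ u * ((γ u)⁻¹ * (k⁻¹ * l) * γ u) * (γ u)⁻¹ = k⁻¹ * l := by group
          change _ ∈ T₁.edgeStab u u'
          rw [this]
          constructor
          · change T₁.act (k⁻¹ * l) u = u
            rw [T₁.act_mul, hl, ← hk, T₁.act_inv_act]
          · change T₁.act (k⁻¹ * l) u' = u'
            rw [T₁.act_mul, hl', ← hk', T₁.act_inv_act]
        have hprod : (γ r)⁻¹ * l * γ u = x₀ * ((γ u)⁻¹ * (k⁻¹ * l) * γ u) := by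
          rw [hx₀_def]; group
        simp only [hprod]
        rw [T₂.act_mul, hz _ (Or.inr hmem), hz _ (Or.inl rfl)]
      · obtain ⟨rfl, hs, rfl⟩ := hx
        refine (hstab _ _ (hfix hs)).imp fun z hz => ?_
        rintro _ ⟨-, -, rfl⟩
        exact hz
    · rcases i with ⟨⟨u, _⟩, ⟨u', _⟩, ⟨r, _⟩, ⟨r', _⟩⟩ | ⟨⟨s, _⟩, ⟨u, _⟩, ⟨r, _⟩⟩
      · rintro _ ⟨k, rfl, -, hk, -, rfl⟩
        exact hfix hk
      · rintro _ ⟨rfl, hs, rfl⟩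
        exact hfix hs
  choose y hy using hZ
  have hyγ : ∀ {k u r}, T₁.act k u = r → (γ r)⁻¹ * k * γ u ∈ ⋃ i, Z (ρ u) i →
      T₂.act k (T₂.act (γ u) (y (ρ u))) = T₂.act (γ r) (y (ρ r)) := by
    rintro k u _ rfl hmem
    have := hy _ _ hmem
    rw [hρ, ← T₂.act_mul]
    conv_rhs => rw [← this, ← T₂.act_mul]
    congr 1
    group
  refine ⟨fun u => T₂.act (γ u) (y (ρ u)), ?_, ?_⟩
  · intro u hu u' hu' r hr r' hr' hadj k hk hk'
    exact hyγ hk (Set.mem_iUnion.mpr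
      ⟨.inl (⟨u, hu⟩, ⟨u', hu'⟩, ⟨r, hr⟩, ⟨r', hr'⟩), k, rfl, hadj, hk, hk', rfl⟩)
  · intro s hs u hu r hr hsu
    exact hyγ hsu (Set.mem_iUnion.mpr ⟨.inr (⟨s, hs⟩, ⟨u, hu⟩, ⟨r, hr⟩), rfl, hsu, rfl⟩)

/-- The graph on `T₁.V × T₂.V` whose edges are the `G`-translates of the edges joining
`(u, y u)` to `(u', y u')`, for `u, u' ∈ X` adjacent in `T₁`. -/
def liftGraph (T₁ T₂ : GTree G) (X : Set T₁.V) (y : T₁.V → T₂.V) :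
    SimpleGraph (T₁.V × T₂.V) where
  Adj a b := ∃ g, ∃ u ∈ X, ∃ u' ∈ X, T₁.graph.Adj u u' ∧
    a = (T₁.act g u, T₂.act g (y u)) ∧ b = (T₁.act g u', T₂.act g (y u'))
  symm := ⟨by
    rintro a b ⟨g, u, hu, u', hu', hadj, ha, hb⟩
    exact ⟨g, u', hu', u, hu, hadj.symm, hb, ha⟩⟩
  loopless := ⟨by
    rintro a ⟨g, u, hu, u', hu', hadj, ha, hb⟩
    exact (T₁.act_adj g _ _ hadj).ne (congrArg Prod.fst (ha.symm.trans hb))⟩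

/-- The projection of `liftGraph` to the first tree. -/
def liftGraphFst (T₁ T₂ : GTree G) (X : Set T₁.V) (y : T₁.V → T₂.V) :
    T₁.liftGraph T₂ X y →g T₁.graph where
  toFun := Prod.fst
  map_rel' := by
    rintro _ _ ⟨g, u, -, u', -, hadj, rfl, rfl⟩
    exact T₁.act_adj g _ _ hadj

/-- The diagonal action of an element of `G` on `liftGraph`. -/
def liftGraphAct (T₁ T₂ : GTree G) (X : Set T₁.V) (y : T₁.V → T₂.V) (g : G) :
    T₁.liftGraph T₂ X y →g T₁.liftGraph T₂ X y where
  toFun a := (T₁.act g a.1, T₂.act g a.2)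
  map_rel' := by
    rintro _ _ ⟨h, u, hu, u', hu', hadj, rfl, rfl⟩
    exact ⟨g * h, u, hu, u', hu', hadj, by simp [T₁.act_mul, T₂.act_mul],
      by simp [T₁.act_mul, T₂.act_mul]⟩

theorem liftGraph_reachable_of_walk {T₁ T₂ : GTree G} {X : Set T₁.V} {y : T₁.V → T₂.V}
    {a b : T₁.V} (w : T₁.graph.Walk a b) (hw : ∀ c ∈ w.support, c ∈ X) :
    (T₁.liftGraph T₂ X y).Reachable (a, y a) (b, y b) := by
  induction w with
  | nil => rfl
  | @cons a c b hac w ih =>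
    rw [Walk.support_cons, List.forall_mem_cons] at hw
    have hadj : (T₁.liftGraph T₂ X y).Adj (a, y a) (c, y c) :=
      ⟨1, a, hw.1, c, hw.2 c w.start_mem_support, hac, by simp [act_one], by simp [act_one]⟩
    exact hadj.reachable.trans (ih hw.2)

end GTree

/-- if edge stabilizers of `T₁` are elliptic in `T₂` and every element
elliptic in `T₁` is elliptic in `T₂`, then `T₁` dominates `T₂`. -/
theorem dominates_of_elliptic_elements {G : Type u} [Group G] (hfg : Group.FG G)
    (T₁ T₂ : GTree G)
    (hell : ∀ a b : T₁.V, T₁.graph.Adj a b → T₂.EllipticSubgroup (T₁.edgeStab a b))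
    (helts : ∀ g : G, T₁.EllipticElt g → T₂.EllipticElt g) :
    T₁.Dominates T₂ := by
  rintro H ⟨v, hv⟩
  obtain ⟨S, hS⟩ := Group.fg_def.mp hfg
  have w : ∀ s : G, T₁.graph.Walk v (T₁.act s v) := fun s => (T₁.connected v _).some
  let X : Set T₁.V := ⋃ s ∈ S, {c | c ∈ (w s).support}
  have hX : ∀ s ∈ S, ∀ c ∈ (w s).support, c ∈ X := fun s hs c hc =>
    Set.mem_iUnion₂.mpr ⟨s, hs, hc⟩
  have : Finite X := Set.Finite.biUnion S.finite_toSet fun s _ => List.finite_toSet _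
  obtain ⟨y, hy, hyS⟩ := GTree.exists_compatible_map hell helts X (S : Set G)
  have hloc : ∀ ⦃a b c⦄, (T₁.liftGraph T₂ X y).Adj a b → (T₁.liftGraph T₂ X y).Adj a c →
      T₁.liftGraphFst T₂ X y b = T₁.liftGraphFst T₂ X y c → b = c := by
    rintro a b c ⟨g, u, hu, u', hu', hadj, ha, rfl⟩ ⟨h, r, hr, r', hr', -, ha', rfl⟩ heq
    have heq' : T₁.act g u' = T₁.act h r' := heq
    have hur : T₁.act g u = T₁.act h r := congrArg Prod.fst (ha.symm.trans ha')
    have := hy u' hu' u hu r' hr' r hr hadj.symm (h⁻¹ * g)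
      (by rw [T₁.act_mul, heq', T₁.act_inv_act]) (by rw [T₁.act_mul, hur, T₁.act_inv_act])
    rw [← heq', ← this, T₂.act_mul, T₂.act_act_inv]
  have hreach : ∀ g : G,
      (T₁.liftGraph T₂ X y).Reachable (v, y v) (T₁.act g v, T₂.act g (y v)) := by
    intro g
    have hg : g ∈ Subgroup.closure (S : Set G) := hS ▸ Subgroup.mem_top g
    induction hg using Subgroup.closure_induction with
    | mem s hs =>
      rw [hyS s hs v (hX s hs v (w s).start_mem_support) _
        (hX s hs _ (w s).end_mem_support) rfl]
      exact GTree.liftGraph_reachable_of_walk (w s) (hX s hs)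
    | one => rw [T₁.act_one, T₂.act_one]
    | mul g h _ _ hg hh =>
      rw [T₁.act_mul, T₂.act_mul]
      exact hg.trans (hh.map (T₁.liftGraphAct T₂ X y g))
    | inv g _ hg =>
      have := hg.map (T₁.liftGraphAct T₂ X y g⁻¹)
      simpa [GTree.liftGraphAct] using this.symm
  refine ⟨y v, fun h hh => ?_⟩
  have := (hreach h).eq_of_map_eq (T₁.liftGraphFst T₂ X y) T₁.acyclic hloc (hv h hh).symm
  exact (congrArg Prod.snd this).symm
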